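/- Assume Conditions B1–B2 and let θ ∈ (0,1). Then sup{ P( sup_{t∈T̃} f(t) > b | sup_{t∈T} f(t) > b ) : T̃ ⊂ T finite with #(T̃) ≤ b^{θd} } → 0 as b → ∞. -/

import Mathlib

open MeasureTheory ProbabilityTheory Filter
open scoped Classical

noncomputable section

/-- The ℓ¹ norm `|x| = ∑ⱼ |xⱼ|` on `ℝ^d`. -/
def nrm {d : ℕ} (x : Fin d → ℝ) : ℝ := ∑ j, |x j|

section GaussianFields

open scoped Topology NNReal ENNReal Pointwise

section CenteredGaussian

variable {Ω : Type*} [MeasurableSpace Ω] {P : Measure Ω}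

/-- A process all of whose finite linear combinations are centered Gaussian is Gaussian. -/
lemma isGaussianProcess_of_map_sum_eq_gaussianReal {T : Type*} {X : T → Ω → ℝ}
    (hX : ∀ t, Measurable (X t))
    (h : ∀ (n : ℕ) (t : Fin n → T) (c : Fin n → ℝ),
      ∃ v : ℝ≥0, P.map (fun ω => ∑ i, c i * X (t i) ω) = gaussianReal 0 v) :
    IsGaussianProcess X P where
  hasGaussianLaw I := by
    refine ⟨isGaussian_of_map_eq_gaussianReal fun L => ?_⟩
    let e := I.equivFin.symm
    obtain ⟨v, hv⟩ := h I.card (fun i => (e i : T)) (fun i => L (Pi.single (e i) 1))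
    refine ⟨0, v, ?_⟩
    rw [Measure.map_map (by fun_prop) (by fun_prop), ← hv]
    congr 1
    ext ω
    have key := L.toLinearMap.pi_apply_eq_sum_univ (I.restrict (X · ω))
    simp only [Function.comp_apply]
    rw [← e.sum_comp] at key
    refine key.trans (Finset.sum_congr rfl fun i _ => ?_)
    simp only [ContinuousLinearMap.coe_coe, smul_eq_mul, Finset.restrict]
    rw [mul_comm]
    congr 2
    ext j
    simp [Pi.single_apply, eq_comm]

/-- The variance parameter of a centered real Gaussian variable is its second moment. -/
lemma map_eq_gaussianReal_integral_sq {X : Ω → ℝ} (hX : Measurable X) {v : ℝ≥0}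
    (h : P.map X = gaussianReal 0 v) : ∫ ω, X ω ^ 2 ∂P = v := by
  have h1 : ∫ x, x ^ 2 ∂(P.map X) = ∫ ω, X ω ^ 2 ∂P :=
    integral_map hX.aemeasurable (by fun_prop)
  rw [← h1, h]
  have h2 := variance_fun_id_gaussianReal (μ := 0) (v := v)
  rw [variance_eq_integral (by fun_prop)] at h2
  simpa [integral_id_gaussianReal] using h2

end CenteredGaussian

/-- A centered, unit-variance, stationary Gaussian field on `ℝ^d` with almost surely `C²` paths. -/
structure IsSmoothStationaryGaussianField {Ω : Type*} [MeasurableSpace Ω] {d : ℕ}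
    (f : (Fin d → ℝ) → Ω → ℝ) (P : Measure Ω) : Prop where
  measurable : ∀ t, Measurable (f t)
  gaussian : ∀ (n : ℕ) (t : Fin n → (Fin d → ℝ)) (c : Fin n → ℝ),
      ∃ v : ℝ≥0, P.map (fun ω => ∑ i, c i * f (t i) ω) = gaussianReal 0 v
  integral_sq_zero : ∫ ω, (f 0 ω) ^ 2 ∂P = 1
  stationary : ∀ (n : ℕ) (t : Fin n → (Fin d → ℝ)) (h : Fin d → ℝ),
      P.map (fun ω (i : Fin n) => f (t i + h) ω) = P.map (fun ω (i : Fin n) => f (t i) ω)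
  smooth : ∀ᵐ ω ∂P, ContDiff ℝ 2 (fun t => f t ω)

/-- The variogram of a random field: the mean square of the increment `f h - f 0`. -/
def variogram {Ω : Type*} [MeasurableSpace Ω] {d : ℕ} (f : (Fin d → ℝ) → Ω → ℝ)
    (P : Measure Ω) (h : Fin d → ℝ) : ℝ :=
  ∫ ω, (f h ω - f 0 ω) ^ 2 ∂P

namespace IsSmoothStationaryGaussianField

variable {Ω : Type*} [MeasurableSpace Ω] {P : Measure Ω} {d : ℕ}
  {f : (Fin d → ℝ) → Ω → ℝ}

lemma isGaussianProcess (hf : IsSmoothStationaryGaussianField f P) : IsGaussianProcess f P :=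
  isGaussianProcess_of_map_sum_eq_gaussianReal hf.measurable hf.gaussian

lemma map_linear_comb (hf : IsSmoothStationaryGaussianField f P) (s t : Fin d → ℝ) (a b : ℝ) :
    P.map (fun ω => a * f s ω + b * f t ω) =
      gaussianReal 0 (∫ ω, (a * f s ω + b * f t ω) ^ 2 ∂P).toNNReal := by
  have hm := hf.measurable
  obtain ⟨v, hv⟩ := hf.gaussian 2 ![s, t] ![a, b]
  simp only [Fin.sum_univ_two, Matrix.cons_val_zero, Matrix.cons_val_one] at hv
  rw [map_eq_gaussianReal_integral_sq (by fun_prop) hv, hv, Real.toNNReal_coe]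

lemma memLp_two (hf : IsSmoothStationaryGaussianField f P) (t : Fin d → ℝ) : MemLp (f t) 2 P :=
  (hf.isGaussianProcess.hasGaussianLaw_eval t).memLp_two

lemma integral_eq_zero (hf : IsSmoothStationaryGaussianField f P) (t : Fin d → ℝ) :
    ∫ ω, f t ω ∂P = 0 := by
  have h := hf.map_linear_comb t t 1 0
  have h1 : ∫ x, x ∂(P.map (f t)) = ∫ ω, f t ω ∂P :=
    integral_map (hf.measurable t).aemeasurable (by fun_prop)
  simp only [one_mul, zero_mul, add_zero] at h
  rw [← h1]
  have h2 : (fun ω => f t ω) = f t := rfl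
  rw [h2] at h
  rw [h, integral_id_gaussianReal]

lemma integral_sq (hf : IsSmoothStationaryGaussianField f P) (t : Fin d → ℝ) :
    ∫ ω, (f t ω) ^ 2 ∂P = 1 := by
  have hm := hf.measurable
  have h := hf.stationary 1 (fun _ => 0) t
  have h1 : ∫ x : Fin 1 → ℝ, (x 0) ^ 2 ∂(P.map fun ω (i : Fin 1) => f (0 + t) ω) =
      ∫ ω, (f (0 + t) ω) ^ 2 ∂P :=
    integral_map (by fun_prop) ((measurable_pi_apply 0).pow_const 2).aestronglyMeasurable
  have h2 : ∫ x : Fin 1 → ℝ, (x 0) ^ 2 ∂(P.map fun ω (i : Fin 1) => f 0 ω) =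
      ∫ ω, (f 0 ω) ^ 2 ∂P :=
    integral_map (by fun_prop) ((measurable_pi_apply 0).pow_const 2).aestronglyMeasurable
  rw [h, h2, hf.integral_sq_zero, zero_add] at h1
  exact h1.symm

lemma integral_sub_sq (hf : IsSmoothStationaryGaussianField f P) (t h : Fin d → ℝ) :
    ∫ ω, (f (t + h) ω - f t ω) ^ 2 ∂P = variogram f P h := by
  have hm := hf.measurable
  have hs := hf.stationary 2 ![h, 0] t
  have h1 : ∫ x : Fin 2 → ℝ, (x 0 - x 1) ^ 2
      ∂(P.map fun ω (i : Fin 2) => f (![h, 0] i + t) ω) =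
      ∫ ω, (f (h + t) ω - f (0 + t) ω) ^ 2 ∂P :=
    integral_map (by fun_prop) (by fun_prop)
  have h2 : ∫ x : Fin 2 → ℝ, (x 0 - x 1) ^ 2
      ∂(P.map fun ω (i : Fin 2) => f (![h, 0] i) ω) =
      ∫ ω, (f h ω - f 0 ω) ^ 2 ∂P :=
    integral_map (by fun_prop) (by fun_prop)
  rw [hs, h2, zero_add, add_comm h t] at h1
  exact h1.symm

lemma integral_mul (hf : IsSmoothStationaryGaussianField f P) (s t : Fin d → ℝ) :
    ∫ ω, f s ω * f t ω ∂P = 1 - variogram f P (s - t) / 2 := by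
  have h1 := hf.integral_sub_sq t (s - t)
  rw [add_sub_cancel] at h1
  have hi : Integrable (fun ω => f s ω * f t ω) P := (hf.memLp_two s).integrable_mul (hf.memLp_two t)
  have h2 : ∫ ω, (f s ω - f t ω) ^ 2 ∂P =
      ∫ ω, ((f s ω) ^ 2 + (f t ω) ^ 2 - 2 * (f s ω * f t ω)) ∂P := by
    congr 1; ext ω; ring
  have i1 := (hf.memLp_two s).integrable_sq
  have i2 := (hf.memLp_two t).integrable_sq
  have i12 : Integrable (fun ω => (f s ω) ^ 2 + (f t ω) ^ 2) P := i1.add i2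
  rw [integral_sub i12 (hi.const_mul 2), integral_add i1 i2, integral_const_mul,
    hf.integral_sq, hf.integral_sq] at h2
  linarith

lemma map_eval (hf : IsSmoothStationaryGaussianField f P) (t : Fin d → ℝ) :
    P.map (f t) = gaussianReal 0 1 := by
  have h := hf.map_linear_comb t t 1 0
  simp only [one_mul, zero_mul, add_zero, hf.integral_sq, Real.toNNReal_one] at h
  exact h

lemma map_average (hf : IsSmoothStationaryGaussianField f P) (s t : Fin d → ℝ) :
    P.map (fun ω => (f s ω + f t ω) / 2) =
      gaussianReal 0 (1 - variogram f P (s - t) / 4).toNNReal := by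
  have h := hf.map_linear_comb s t (1 / 2) (1 / 2)
  have hi : Integrable (fun ω => f s ω * f t ω) P := (hf.memLp_two s).integrable_mul (hf.memLp_two t)
  have h2 : ∫ ω, (1 / 2 * f s ω + 1 / 2 * f t ω) ^ 2 ∂P =
      ∫ ω, ((1 / 4) * ((f s ω) ^ 2 + (f t ω) ^ 2) + (1 / 2) * (f s ω * f t ω)) ∂P := by
    congr 1; ext ω; ring
  have i1 := (hf.memLp_two s).integrable_sq
  have i2 := (hf.memLp_two t).integrable_sq
  have i12 : Integrable (fun ω => (f s ω) ^ 2 + (f t ω) ^ 2) P := i1.add i2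
  rw [integral_add (i12.const_mul _) (hi.const_mul _), integral_const_mul,
    integral_add i1 i2, integral_const_mul, hf.integral_sq, hf.integral_sq, hf.integral_mul] at h2
  rw [h2] at h
  convert h using 2
  · ext ω; ring
  · congr 1; ring

lemma variogram_nonneg (h : Fin d → ℝ) : 0 ≤ variogram f P h :=
  integral_nonneg fun _ => sq_nonneg _

lemma variogram_zero : variogram f P 0 = 0 := by simp [variogram]

lemma continuous_variogram [IsProbabilityMeasure P] (hf : IsSmoothStationaryGaussianField f P) :
    Continuous (variogram f P) := by
  have hm := hf.measurable
  have key : ∀ h, ∫ ω, Complex.exp (((f h ω - f 0 ω : ℝ) : ℂ) * Complex.I) ∂P =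
      ((Real.exp (-(variogram f P h) / 2) : ℝ) : ℂ) := by
    intro h
    have h1 := hf.map_linear_comb h 0 1 (-1)
    have h2 : (fun ω => 1 * f h ω + -1 * f 0 ω) = fun ω => f h ω - f 0 ω := by ext ω; ring
    have h3 : ∫ ω, (1 * f h ω + -1 * f 0 ω) ^ 2 ∂P = variogram f P h := by
      unfold variogram; congr 1; ext ω; ring
    rw [h2, h3] at h1
    have h4 := charFun_gaussianReal (μ := 0) (v := (variogram f P h).toNNReal) 1
    rw [← h1, charFun_apply_real, integral_map (by fun_prop) (by fun_prop)] at h4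
    rw [Real.coe_toNNReal _ (variogram_nonneg h)] at h4
    simp only [Complex.ofReal_one, one_mul, Complex.ofReal_zero, zero_mul, mul_zero, zero_sub,
      one_pow, mul_one] at h4
    rw [h4]
    push_cast
    ring_nf
  have hc : Continuous fun h => ∫ ω, Complex.exp (((f h ω - f 0 ω : ℝ) : ℂ) * Complex.I) ∂P := by
    refine continuous_of_dominated (bound := fun _ => 1) (fun h => by fun_prop) (fun h => ?_)
      (integrable_const _) ?_
    · exact Eventually.of_forall fun ω => (Complex.norm_exp_ofReal_mul_I _).le
    · filter_upwards [hf.smooth] with ω hω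
      have := hω.continuous
      fun_prop
  simp_rw [key] at hc
  have h5 : Continuous fun h => Real.exp (-(variogram f P h) / 2) := by
    have := Complex.continuous_re.comp hc
    simpa only [Function.comp_def, Complex.ofReal_re] using this
  have h6 : variogram f P = fun h => -2 * Real.log (Real.exp (-(variogram f P h) / 2)) := by
    ext h; rw [Real.log_exp]; ring
  rw [h6]
  exact continuous_const.mul (h5.log fun h => (Real.exp_pos _).ne')

end IsSmoothStationaryGaussianField

/-- If the second moments of an almost surely convergent sequence tend to zero, then its limit
vanishes almost surely. -/
lemma ae_eq_zero_of_tendsto_integral_sq {Ω : Type*} [MeasurableSpace Ω] {P : Measure Ω}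
    {X : ℕ → Ω → ℝ} {g : Ω → ℝ} (hm : ∀ n, Measurable (X n))
    (hi : ∀ n, Integrable (fun ω => X n ω ^ 2) P)
    (hlim : ∀ᵐ ω ∂P, Tendsto (fun n => X n ω) atTop (𝓝 (g ω)))
    (h0 : Tendsto (fun n => ∫ ω, X n ω ^ 2 ∂P) atTop (𝓝 0)) : ∀ᵐ ω ∂P, g ω = 0 := by
  have hF := lintegral_liminf_le (μ := P) (u := atTop)
    (f := fun n ω => ENNReal.ofReal (X n ω ^ 2)) fun n => ((hm n).pow_const 2).ennreal_ofReal
  have h1 : ∀ n, ∫⁻ ω, ENNReal.ofReal (X n ω ^ 2) ∂P = ENNReal.ofReal (∫ ω, X n ω ^ 2 ∂P) :=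
    fun n => (ofReal_integral_eq_lintegral_ofReal (hi n)
      (Eventually.of_forall fun _ => sq_nonneg _)).symm
  have h2 : liminf (fun n => ∫⁻ ω, ENNReal.ofReal (X n ω ^ 2) ∂P) atTop = 0 := by
    simp_rw [h1]
    have := (ENNReal.continuous_ofReal.tendsto 0).comp h0
    rw [ENNReal.ofReal_zero] at this
    exact this.liminf_eq
  rw [h2, nonpos_iff_eq_zero, lintegral_eq_zero_iff'
    (Measurable.liminf fun n => ((hm n).pow_const 2).ennreal_ofReal).aemeasurable] at hF
  filter_upwards [hF, hlim] with ω h3 h4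
  have h5 : Tendsto (fun n => ENNReal.ofReal (X n ω ^ 2)) atTop (𝓝 (ENNReal.ofReal (g ω ^ 2))) :=
    (ENNReal.continuous_ofReal.tendsto _).comp (h4.pow 2)
  rw [h5.liminf_eq] at h3
  simpa [ENNReal.ofReal_eq_zero, sq_nonpos_iff] using h3

namespace IsSmoothStationaryGaussianField

variable {Ω : Type*} [MeasurableSpace Ω] {P : Measure Ω} {d : ℕ} {f : (Fin d → ℝ) → Ω → ℝ}

lemma integrable_sub_sq (hf : IsSmoothStationaryGaussianField f P) (s t : Fin d → ℝ) :
    Integrable (fun ω => (f s ω - f t ω) ^ 2) P :=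
  ((hf.memLp_two s).sub (hf.memLp_two t)).integrable_sq

lemma variogram_eq_zero_of_ae {h : Fin d → ℝ} (hh : ∀ᵐ ω ∂P, f h ω = f 0 ω) :
    variogram f P h = 0 := by
  unfold variogram
  rw [integral_eq_zero_of_ae]
  filter_upwards [hh] with ω hω
  simp [hω]

/-- A lag at which the variogram vanishes is almost surely a period of the paths. -/
lemma ae_periodic_of_variogram_eq_zero (hf : IsSmoothStationaryGaussianField f P)
    {h : Fin d → ℝ} (hh : variogram f P h = 0) : ∀ᵐ ω ∂P, ∀ t, f (t + h) ω = f t ω := by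
  have h1 : ∀ t, ∀ᵐ ω ∂P, f (t + h) ω = f t ω := by
    intro t
    have h2 := hf.integral_sub_sq t h
    rw [hh, integral_eq_zero_iff_of_nonneg (fun _ => sq_nonneg _)
      (hf.integrable_sub_sq _ _)] at h2
    filter_upwards [h2] with ω hω
    simpa [sub_eq_zero] using hω
  have h3 := ae_all_iff.2 fun n : ℕ => h1 (TopologicalSpace.denseSeq (Fin d → ℝ) n)
  filter_upwards [h3, hf.smooth] with ω h4 h5 t
  have hc := h5.continuous
  refine congrFun (Continuous.ext_on (TopologicalSpace.denseRange_denseSeq (Fin d → ℝ))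
    (f := fun t => f (t + h) ω) (g := fun t => f t ω) (by fun_prop) hc ?_) t
  rintro _ ⟨n, rfl⟩
  exact h4 n

lemma variogram_add_eq_zero (hf : IsSmoothStationaryGaussianField f P)
    {h k : Fin d → ℝ} (hh : variogram f P h = 0) (hk : variogram f P k = 0) :
    variogram f P (h + k) = 0 := by
  refine variogram_eq_zero_of_ae ?_
  filter_upwards [hf.ae_periodic_of_variogram_eq_zero hh,
    hf.ae_periodic_of_variogram_eq_zero hk] with ω h1 h2
  have := h1 0
  rw [h2, ← this, zero_add]

lemma variogram_neg_eq_zero (hf : IsSmoothStationaryGaussianField f P)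
    {h : Fin d → ℝ} (hh : variogram f P h = 0) : variogram f P (-h) = 0 := by
  refine variogram_eq_zero_of_ae ?_
  filter_upwards [hf.ae_periodic_of_variogram_eq_zero hh] with ω h1
  rw [← h1 (-h), neg_add_cancel]

/-- The directions along which the field is almost surely constant. -/
def nullDirections (hf : IsSmoothStationaryGaussianField f P) : Submodule ℝ (Fin d → ℝ) where
  carrier := {v | ∀ s : ℝ, variogram f P (s • v) = 0}
  zero_mem' s := by simp [variogram_zero]
  add_mem' hv hw s := by
    rw [smul_add]
    exact hf.variogram_add_eq_zero (hv s) (hw s)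
  smul_mem' c v hv s := by
    rw [smul_smul]
    exact hv _

lemma variogram_eq_zero_of_mem_nullDirections (hf : IsSmoothStationaryGaussianField f P)
    {v : Fin d → ℝ} (hv : v ∈ hf.nullDirections) : variogram f P v = 0 := by
  simpa using hv 1

/-- A limiting direction along which the variogram is `o(‖h‖²)` is a null direction. -/
lemma mem_nullDirections_of_tendsto (hf : IsSmoothStationaryGaussianField f P)
    {h : ℕ → (Fin d → ℝ)} {u : Fin d → ℝ} (h0 : ∀ n, h n ≠ 0) (hlim : Tendsto h atTop (𝓝 0))
    (hu : Tendsto (fun n => ‖h n‖⁻¹ • h n) atTop (𝓝 u))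
    (hq : Tendsto (fun n => variogram f P (h n) / ‖h n‖ ^ 2) atTop (𝓝 0)) :
    u ∈ hf.nullDirections := by
  have hm := hf.measurable
  have hnorm : Tendsto (fun n => ‖h n‖⁻¹) atTop atTop := by
    refine tendsto_inv_nhdsGT_zero.comp (tendsto_nhdsWithin_iff.2 ⟨?_, ?_⟩)
    · simpa using hlim.norm
    · exact Eventually.of_forall fun n => norm_pos_iff.2 (h0 n)
  have h1 : ∀ t, ∀ᵐ ω ∂P, fderiv ℝ (fun t => f t ω) t u = 0 := by
    intro t
    refine ae_eq_zero_of_tendsto_integral_sq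
      (X := fun n ω => ‖h n‖⁻¹ * (f (t + h n) ω - f t ω)) (fun n => by fun_prop) ?_ ?_ ?_
    · intro n
      simp_rw [mul_pow]
      exact (hf.integrable_sub_sq _ _).const_mul _
    · filter_upwards [hf.smooth] with ω hω
      have hd := ((hω.differentiable (by norm_num)) t).hasFDerivAt.hasFDerivWithinAt (s := Set.univ)
      have := hd.lim (d := h) (c := fun n => ‖h n‖⁻¹) (l := atTop)
        hlim (Eventually.of_forall fun _ => Set.mem_univ _) hu
      simpa only [smul_eq_mul] using this
    · refine hq.congr fun n => ?_
      simp_rw [mul_pow]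
      rw [integral_const_mul, hf.integral_sub_sq, inv_pow, div_eq_inv_mul]
  have h2 := ae_all_iff.2 fun n : ℕ => h1 (TopologicalSpace.denseSeq (Fin d → ℝ) n)
  intro s
  refine variogram_eq_zero_of_ae ?_
  filter_upwards [h2, hf.smooth] with ω h4 h5
  have hc := h5.continuous_fderiv (by norm_num)
  have h6 : ∀ t, fderiv ℝ (fun t => f t ω) t u = 0 := by
    intro t
    refine congrFun (Continuous.ext_on (TopologicalSpace.denseRange_denseSeq (Fin d → ℝ))
      (f := fun t => fderiv ℝ (fun t => f t ω) t u) (g := fun _ => 0) (by fun_prop)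
      continuous_const ?_) t
    rintro _ ⟨n, rfl⟩
    exact h4 n
  have h7 : ∀ x : ℝ, HasDerivAt (fun x : ℝ => f (x • u) ω) 0 x := by
    intro x
    have := ((h5.differentiable (by norm_num)) (x • u)).hasFDerivAt.comp_hasDerivAt x
      ((hasDerivAt_id x).smul_const u)
    simpa [h6, Function.comp_def] using this
  have h8 := is_const_of_deriv_eq_zero (fun x => (h7 x).differentiableAt)
    (fun x => (h7 x).deriv) s 0
  simpa using h8

/-- Transversally to the null directions, the variogram grows quadratically near the origin. -/
lemma exists_variogram_lower_bound (hf : IsSmoothStationaryGaussianField f P)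
    {W : Submodule ℝ (Fin d → ℝ)} (hW : Disjoint W hf.nullDirections) :
    ∃ c > 0, ∃ r > 0, ∀ h ∈ W, ‖h‖ < r → c * ‖h‖ ^ 2 ≤ variogram f P h := by
  by_contra! hcon
  have h1 : ∀ n : ℕ, ∃ h ∈ W, ‖h‖ < 1 / ((n : ℝ) + 1) ∧
      variogram f P h < 1 / ((n : ℝ) + 1) * ‖h‖ ^ 2 := fun n =>
    hcon _ Nat.one_div_pos_of_nat _ Nat.one_div_pos_of_nat
  choose h hhW hlt hq using h1
  have h0 : ∀ n, h n ≠ 0 := by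
    intro n hn
    have := hq n
    rw [hn, variogram_zero] at this
    simp at this
  have hpos : ∀ n, 0 < ‖h n‖ := fun n => norm_pos_iff.2 (h0 n)
  have hsphere : ∀ n, ‖h n‖⁻¹ • h n ∈ Metric.sphere (0 : Fin d → ℝ) 1 := by
    intro n
    simp [norm_smul, (hpos n).ne']
  obtain ⟨u, hu, φ, hφ, hlim⟩ := (isCompact_sphere (0 : Fin d → ℝ) 1).tendsto_subseq hsphere
  have hinv := tendsto_one_div_add_atTop_nhds_zero_nat (𝕜 := ℝ)
  have huV : u ∈ hf.nullDirections := by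
    refine hf.mem_nullDirections_of_tendsto (h := h ∘ φ) (fun n => h0 _) ?_ hlim ?_
    · refine Tendsto.comp ?_ hφ.tendsto_atTop
      exact squeeze_zero_norm (fun n => (hlt n).le) hinv
    · refine Tendsto.comp (g := fun n => variogram f P (h n) / ‖h n‖ ^ 2) ?_ hφ.tendsto_atTop
      refine squeeze_zero (fun n => div_nonneg (variogram_nonneg _) (sq_nonneg _)) (fun n => ?_) hinv
      rw [div_le_iff₀ (pow_pos (hpos n) 2)]
      exact (hq n).le
  have huW : u ∈ W :=
    W.closed_of_finiteDimensional.mem_of_tendsto hlim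
      (Eventually.of_forall fun n => W.smul_mem _ (hhW _))
  have := Submodule.disjoint_def.1 hW u huW huV
  simp [this] at hu

end IsSmoothStationaryGaussianField

namespace IsSmoothStationaryGaussianField

variable {Ω : Type*} [MeasurableSpace Ω] {P : Measure Ω} {d : ℕ} {f : (Fin d → ℝ) → Ω → ℝ}

/-- The residuals of the linear regression of the field on its value at one point are independent
of that value. -/
lemma indepFun_regression_residual (hf : IsSmoothStationaryGaussianField f P)
    (t₀ : Fin d → ℝ) :
    IndepFun (fun ω (_ : Unit) => f t₀ ω)
      (fun ω (t : Fin d → ℝ) => f t ω - (1 - variogram f P (t - t₀) / 2) * f t₀ ω) P := by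
  have hP : IsProbabilityMeasure P := hf.isGaussianProcess.isProbabilityMeasure
  have hm := hf.measurable
  refine IsGaussianProcess.indepFun_of_covariance_eq_zero (X := fun _ : Unit => f t₀)
    (Y := fun t ω => f t ω - (1 - variogram f P (t - t₀) / 2) * f t₀ ω) ?_
    (fun _ => (hm t₀).aemeasurable) (fun t => by fun_prop) ?_
  · refine hf.isGaussianProcess.of_isGaussianProcess ?_
    rintro (_ | t)
    · exact ⟨{t₀}, ContinuousLinearMap.proj ⟨t₀, by simp⟩, fun ω => rfl⟩
    · exact ⟨{t, t₀}, ContinuousLinearMap.proj ⟨t, by simp⟩ -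
        (1 - variogram f P (t - t₀) / 2) • ContinuousLinearMap.proj ⟨t₀, by simp⟩, fun ω => rfl⟩
  · intro _ t
    have hL : MemLp (fun ω => f t ω - (1 - variogram f P (t - t₀) / 2) * f t₀ ω) 2 P :=
      (hf.memLp_two t).sub ((hf.memLp_two t₀).const_mul _)
    rw [covariance_eq_sub (hf.memLp_two t₀) hL, hf.integral_eq_zero, zero_mul,
      sub_zero]
    have h1 : ∀ ω, (f t₀ * fun ω => f t ω - (1 - variogram f P (t - t₀) / 2) * f t₀ ω) ω =
        f t ω * f t₀ ω - (1 - variogram f P (t - t₀) / 2) * (f t₀ ω) ^ 2 := by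
      intro ω; simp only [Pi.mul_apply]; ring
    simp_rw [h1]
    have hi : Integrable (fun ω => f t ω * f t₀ ω) P :=
      (hf.memLp_two t).integrable_mul (hf.memLp_two t₀)
    rw [integral_sub hi ((hf.memLp_two t₀).integrable_sq.const_mul _), integral_const_mul, hf.integral_sq,
      hf.integral_mul]
    ring

lemma measure_lt_eval_pos (hf : IsSmoothStationaryGaussianField f P) (t : Fin d → ℝ) (z : ℝ) :
    P {ω | z < f t ω} ≠ 0 := by
  have h1 : P {ω | z < f t ω} = gaussianReal 0 1 (Set.Ioi z) := by
    rw [← hf.map_eval t, Measure.map_apply (hf.measurable t) measurableSet_Ioi]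
    rfl
  rw [h1]
  intro h
  have := gaussianReal_absolutelyContinuous' 0 one_ne_zero h
  simp at this

/-- The field exceeds at `t₀`, with positive probability, its values on any compact set of points
that are not perfectly correlated with `t₀`. -/
lemma not_ae_exists_ge_of_variogram_ne_zero (hf : IsSmoothStationaryGaussianField f P)
    {F : Set (Fin d → ℝ)} (hF : IsCompact F) {t₀ : Fin d → ℝ}
    (hq : ∀ t ∈ F, variogram f P (t - t₀) ≠ 0) :
    ¬ ∀ᵐ ω ∂P, ∃ t ∈ F, f t₀ ω ≤ f t ω := by
  intro hae
  have hP : IsProbabilityMeasure P := hf.isGaussianProcess.isProbabilityMeasure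
  have hqc := hf.continuous_variogram
  obtain ⟨ω₁, t₁, ht₁, -⟩ := hae.exists
  obtain ⟨t₂, ht₂, hmin⟩ := hF.exists_isMinOn ⟨t₁, ht₁⟩
    (f := fun t => variogram f P (t - t₀)) (by fun_prop)
  set δ := variogram f P (t₂ - t₀) / 2 with hδ
  have hδpos : 0 < δ := half_pos ((variogram_nonneg _).lt_of_ne' (hq t₂ ht₂))
  have hδle : ∀ t ∈ F, δ ≤ variogram f P (t - t₀) / 2 := fun t ht => by
    have : variogram f P (t₂ - t₀) ≤ variogram f P (t - t₀) := hmin ht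
    linarith
  set W : Ω → (Fin d → ℝ) → ℝ :=
    fun ω t => f t ω - (1 - variogram f P (t - t₀) / 2) * f t₀ ω with hW
  have hne : Nonempty F := ⟨⟨t₁, ht₁⟩⟩
  let D : ℕ → F := TopologicalSpace.denseSeq F
  have hD : DenseRange D := TopologicalSpace.denseRange_denseSeq F
  let B : ℕ → Set ((Fin d → ℝ) → ℝ) := fun K => {w | ∀ n, |w (D n)| ≤ K}
  have hBm : ∀ K, MeasurableSet (B K) := by
    intro K
    simp only [B, Set.ofPred_forall]
    exact MeasurableSet.iInter fun n =>
      measurableSet_le (measurable_pi_apply _).abs measurable_const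
  have hWc : ∀ᵐ ω ∂P, Continuous (W ω) := by
    filter_upwards [hf.smooth] with ω hω
    have := hω.continuous
    fun_prop
  obtain ⟨K, hK⟩ : ∃ K, P {ω | W ω ∈ B K} ≠ 0 := by
    by_contra! hcon
    have h1 : ∀ᵐ ω ∂P, ∀ K, W ω ∉ B K := ae_all_iff.2 fun K => by
      rw [ae_iff]; simpa using hcon K
    obtain ⟨ω, h2, h3⟩ := (h1.and hWc).exists
    obtain ⟨C, hC⟩ := hF.exists_bound_of_continuousOn h3.continuousOn
    obtain ⟨K, hK⟩ := exists_nat_ge C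
    exact h2 K fun n => (hC (D n) (D n).2).trans hK
  have hind := (hf.indepFun_regression_residual t₀).measure_inter_preimage_eq_mul
    {x | (K : ℝ) / δ < x ()} (B K)
    (measurableSet_lt measurable_const (measurable_pi_apply _)) (hBm K)
  have hpos : P ({ω | (K : ℝ) / δ < f t₀ ω} ∩ {ω | W ω ∈ B K}) ≠ 0 := by
    refine ne_of_eq_of_ne hind (mul_ne_zero (hf.measure_lt_eval_pos t₀ _) hK)
  refine hpos (measure_mono_null ?_ (ae_iff.1 (hae.and hWc)))
  rintro ω ⟨h1, h2⟩ ⟨⟨t, ht, htle⟩, h3⟩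
  have h4 : ∀ t : F, |W ω t| ≤ K := by
    intro t
    refine hD.induction_on (p := fun t : F => |W ω t| ≤ K) t
      (isClosed_le (by fun_prop) continuous_const) h2
  have h5 := (le_abs_self _).trans (h4 ⟨t, ht⟩)
  simp only [hW, Set.mem_ofPred_eq] at h5 h1
  rw [div_lt_iff₀ hδpos] at h1
  have hz : 0 < f t₀ ω := by
    by_contra! hz
    have : f t₀ ω * δ ≤ 0 := mul_nonpos_of_nonpos_of_nonneg hz hδpos.le
    have : (0 : ℝ) ≤ K := K.cast_nonneg
    linarith
  nlinarith [mul_le_mul_of_nonneg_right (hδle t ht) hz.le]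

lemma ae_constant_along_nullDirections (hf : IsSmoothStationaryGaussianField f P) :
    ∀ᵐ ω ∂P, ∀ v ∈ hf.nullDirections, ∀ t, f (t + v) ω = f t ω := by
  have h1 := ae_all_iff.2 fun n : ℕ => hf.ae_periodic_of_variogram_eq_zero
    (hf.variogram_eq_zero_of_mem_nullDirections
      (TopologicalSpace.denseSeq hf.nullDirections n).2)
  filter_upwards [h1, hf.smooth] with ω h2 h3 v hv t
  have hc := h3.continuous
  exact (TopologicalSpace.denseRange_denseSeq hf.nullDirections).induction_on
    (p := fun v => f (t + v) ω = f t ω) ⟨v, hv⟩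
    (isClosed_eq (by fun_prop) continuous_const) fun n => h2 n t

/-- If the maximum over a convex body is almost surely attained at a unique point, then no
directional derivative of the field vanishes identically. -/
lemma nullDirections_eq_bot (hf : IsSmoothStationaryGaussianField f P)
    {T : Set (Fin d → ℝ)} (hTcompact : IsCompact T) (hTconv : Convex ℝ T)
    (hTint : (interior T).Nonempty)
    (huniq : ∀ᵐ ω ∂P, ∃! t, t ∈ T ∧ ∀ s ∈ T, f s ω ≤ f t ω) :
    hf.nullDirections = ⊥ := by
  set V := hf.nullDirections with hV
  by_contra hbot
  obtain ⟨u, huV, hu0⟩ := V.ne_bot_iff.1 hbot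
  obtain ⟨W, hVW⟩ := V.exists_isCompl
  obtain ⟨c, hc, r, hr, hlow⟩ := hf.exists_variogram_lower_bound hVW.symm.disjoint
  let Λ : Set (Fin d → ℝ) := {w | w ∈ W ∧ variogram f P w = 0}
  have hΛ : Λ.Countable := by
    have : DiscreteTopology Λ := by
      refine DiscreteTopology.of_forall_le_dist hr ?_
      rintro ⟨x, hxW, hx⟩ ⟨y, hyW, hy⟩ hxy
      by_contra! hlt
      rw [Subtype.dist_eq, dist_eq_norm] at hlt
      have h1 := hlow (x - y) (W.sub_mem hxW hyW) hlt
      have h2 : variogram f P (x - y) = 0 := by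
        rw [sub_eq_add_neg]
        exact hf.variogram_add_eq_zero hx (hf.variogram_neg_eq_zero hy)
      have h3 : 0 < ‖x - y‖ := norm_pos_iff.2 (sub_ne_zero.2 fun h => hxy (Subtype.ext h))
      have : 0 < c * ‖x - y‖ ^ 2 := by positivity
      linarith
    exact Set.countable_coe_iff.1 (TopologicalSpace.separableSpace_iff_countable.1 inferInstance)
  let U : Set (Fin d → ℝ) := interior T + (V : Set (Fin d → ℝ))
  have hUopen : IsOpen U := isOpen_interior.add_right
  have hUconv : Convex ℝ U := hTconv.interior.add V.convex
  have hUfront : volume (frontier U) = 0 := hUconv.addHaar_frontier volume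
  have hTU : T ⊆ closure U := by
    have h1 : interior T ⊆ U := fun x hx => ⟨x, hx, 0, V.zero_mem, add_zero x⟩
    have h2 := hTconv.closure_interior_eq_closure_of_nonempty_interior hTint
    exact (subset_closure.trans h2.superset).trans (closure_mono h1)
  have hUinv : ∀ x, ∀ v ∈ V, x ∈ frontier U → x + v ∈ frontier U := by
    intro x v hv hx
    have h1 : (Homeomorph.addRight v) ⁻¹' U = U := by
      ext y
      constructor
      · rintro ⟨a, ha, b, hb, hab⟩
        refine ⟨a, ha, b - v, V.sub_mem hb hv, ?_⟩
        simp only [Homeomorph.coe_addRight] at hab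
        simp only
        rw [← add_sub_assoc, hab, add_sub_cancel_right]
      · rintro ⟨a, ha, b, hb, rfl⟩
        exact ⟨a, ha, b + v, V.add_mem hb hv, (add_assoc _ _ _).symm⟩
    rw [← h1, ← Homeomorph.preimage_frontier] at hx
    exact hx
  obtain ⟨t₀, ht₀, ht₀N⟩ : ∃ t₀ ∈ interior T, ∀ w ∈ Λ, t₀ + w ∉ frontier U := by
    have hnull : volume (⋃ w ∈ Λ, (fun x => x + w) ⁻¹' frontier U) = 0 := by
      rw [measure_biUnion_null_iff hΛ]
      intro w _
      rw [measure_preimage_add_right, hUfront]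
    by_contra! hcon
    refine (isOpen_interior.measure_pos volume hTint).ne' (measure_mono_null ?_ hnull)
    intro t ht
    obtain ⟨w, hw, h⟩ := hcon t ht
    exact Set.mem_biUnion hw h
  have hF : IsCompact (T ∩ Uᶜ) := hTcompact.inter_right hUopen.isClosed_compl
  refine hf.not_ae_exists_ge_of_variogram_ne_zero hF (t₀ := t₀) ?_ ?_
  · rintro t ⟨htT, htU⟩ hq0
    obtain ⟨v, hv, w, hw, hvw⟩ := Submodule.mem_sup.1
      (show t - t₀ ∈ V ⊔ W by rw [hVW.sup_eq_top]; trivial)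
    have hvar := hf.variogram_eq_zero_of_mem_nullDirections (V.neg_mem hv)
    have hwq : variogram f P w = 0 := by
      have := hf.variogram_add_eq_zero hq0 hvar
      rwa [← hvw, add_neg_cancel_comm] at this
    refine ht₀N w ⟨hw, hwq⟩ ?_
    have htf : t ∈ frontier U := by
      rw [hUopen.frontier_eq]; exact ⟨hTU htT, htU⟩
    have := hUinv t (-v) (V.neg_mem hv) htf
    convert this using 1
    rw [← sub_add_cancel t t₀, ← hvw]; abel
  · filter_upwards [hf.ae_constant_along_nullDirections, huniq] with ω hper hmax
    obtain ⟨t, ⟨htT, htmax⟩, hunique⟩ := hmax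
    refine ⟨t, ⟨htT, ?_⟩, htmax t₀ (interior_subset ht₀)⟩
    rintro ⟨a, ha, v, hv, hav⟩
    have hmaximizer : ∀ s ∈ T, ∀ w ∈ V, t + w = s → s = t := by
      intro s hs w hw hws
      refine hunique s ⟨hs, fun x hx => ?_⟩
      rw [← hws, hper w hw]
      exact htmax x hx
    have hat : a = t := hmaximizer a (interior_subset ha) (-v) (V.neg_mem hv) (by
      simp only at hav; rw [← hav, add_neg_cancel_right])
    subst hat
    have hnhds : ∀ᶠ ε : ℝ in 𝓝 0, a + ε • u ∈ interior T :=
      ContinuousAt.eventually_mem (by fun_prop)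
        (isOpen_interior.mem_nhds (by simpa using ha))
    obtain ⟨ε, hεT, hε0⟩ := ((hnhds.filter_mono nhdsWithin_le_nhds).and
      (self_mem_nhdsWithin (s := {(0 : ℝ)}ᶜ))).exists
    have h1 := hmaximizer _ (interior_subset hεT) (ε • u) (V.smul_mem _ huV) rfl
    have h2 : ε • u = 0 := by simpa using h1
    exact (smul_ne_zero hε0 hu0) h2

end IsSmoothStationaryGaussianField

/-- Comparison of the upper tail of a centered Gaussian law of variance `v ∈ [1/2, 1]` with the
standard one. -/
lemma gaussianReal_Ioi_le {v b : ℝ} (hv : 1 / 2 ≤ v) (hv1 : v ≤ 1) (hb : 0 ≤ b) :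
    (gaussianReal 0 v.toNNReal).real (Set.Ioi b) ≤
      2 * Real.exp (-(b ^ 2 * (1 - v) / 2)) * (gaussianReal 0 1).real (Set.Ioi b) := by
  have hv0 : 0 < v := by linarith
  have hvn : v.toNNReal ≠ 0 := by simpa using hv0
  set C := 2 * Real.exp (-(b ^ 2 * (1 - v) / 2)) with hC
  have hpdf : ∀ x ∈ Set.Ioi b, gaussianPDF 0 v.toNNReal x ≤
      ENNReal.ofReal C * gaussianPDF 0 1 x := by
    intro x hx
    have hx : b < x := hx
    simp only [gaussianPDF]
    rw [← ENNReal.ofReal_mul (by positivity)]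
    refine ENNReal.ofReal_le_ofReal ?_
    simp only [gaussianPDFReal, Real.coe_toNNReal _ hv0.le, NNReal.coe_one, mul_one, sub_zero]
    have hs : (√(2 * Real.pi * v))⁻¹ ≤ 2 * (√(2 * Real.pi))⁻¹ := by
      rw [Real.sqrt_mul (by positivity), mul_inv, mul_comm]
      refine mul_le_mul_of_nonneg_right ?_ (by positivity)
      rw [inv_le_comm₀ (by positivity) (by norm_num)]
      exact Real.le_sqrt_of_sq_le (by linarith)
    have he : Real.exp (-x ^ 2 / (2 * v)) ≤
        Real.exp (-(b ^ 2 * (1 - v) / 2)) * Real.exp (-x ^ 2 / 2) := by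
      rw [← Real.exp_add]
      refine Real.exp_le_exp.2 ?_
      have h1 : b ^ 2 ≤ x ^ 2 := pow_le_pow_left₀ hb hx.le 2
      have h2 : 2 - v ≤ v⁻¹ := by
        rw [← one_div, le_div_iff₀ hv0]
        nlinarith [sq_nonneg (v - 1)]
      have h3 : -x ^ 2 / (2 * v) = -(x ^ 2 * v⁻¹) / 2 := by field_simp
      rw [h3]
      nlinarith [mul_le_mul_of_nonneg_left h2 (sq_nonneg x),
        mul_le_mul_of_nonneg_right h1 (sub_nonneg.2 hv1)]
    calc _ ≤ (2 * (√(2 * Real.pi))⁻¹) *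
          (Real.exp (-(b ^ 2 * (1 - v) / 2)) * Real.exp (-x ^ 2 / 2)) :=
          mul_le_mul hs he (by positivity) (by positivity)
      _ = _ := by rw [hC]; ring
  have key : gaussianReal 0 v.toNNReal (Set.Ioi b) ≤
      ENNReal.ofReal C * gaussianReal 0 1 (Set.Ioi b) := by
    rw [gaussianReal_apply _ hvn, gaussianReal_apply _ one_ne_zero,
      ← lintegral_const_mul _ (measurable_gaussianPDF _ _)]
    exact setLIntegral_mono ((measurable_gaussianPDF _ _).const_mul _) hpdf
  have := ENNReal.toReal_mono (by finiteness) key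
  rwa [ENNReal.toReal_mul, ENNReal.toReal_ofReal (by positivity)] at this

/-- A Bonferroni bound for events of equal probability with rare pairwise intersections. -/
lemma half_card_mul_le_measureReal_iUnion {Ω ι : Type*} [MeasurableSpace Ω] {P : Measure Ω}
    [IsProbabilityMeasure P] [Fintype ι] {A : ι → Set Ω} (hA : ∀ i, MeasurableSet (A i))
    {p ε : ℝ} (hε : 0 ≤ ε) (hp : ∀ i, P.real (A i) = p)
    (hpair : ∀ i j, i ≠ j → P.real (A i ∩ A j) ≤ ε * p)
    (hcard : (Fintype.card ι : ℝ) * ε ≤ 1 / 2) :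
    (Fintype.card ι : ℝ) * p / 2 ≤ P.real (⋃ i, A i) := by
  let C : ι → Set Ω := fun i => ⋃ j ∈ Finset.univ.erase i, A i ∩ A j
  have hCm : ∀ i, MeasurableSet (C i) := fun i =>
    Finset.measurableSet_biUnion _ fun j _ => (hA i).inter (hA j)
  have hCA : ∀ i, C i ⊆ A i := fun i => Set.iUnion₂_subset fun _ _ => Set.inter_subset_left
  have hB : ∀ i, p / 2 ≤ P.real (A i \ C i) := by
    intro i
    have hp0 : 0 ≤ p := hp i ▸ measureReal_nonneg
    have h1 : P.real (C i) ≤ p / 2 := calc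
      P.real (C i) ≤ ∑ j ∈ Finset.univ.erase i, P.real (A i ∩ A j) :=
        measureReal_biUnion_finset_le _ _
      _ ≤ ∑ j ∈ Finset.univ.erase i, ε * p :=
        Finset.sum_le_sum fun j hj => hpair i j (Finset.ne_of_mem_erase hj).symm
      _ ≤ ∑ _j : ι, ε * p :=
        Finset.sum_le_sum_of_subset_of_nonneg (Finset.erase_subset _ _)
          fun _ _ _ => mul_nonneg hε hp0
      _ = Fintype.card ι * ε * p := by simp [mul_assoc]
      _ ≤ p / 2 := by nlinarith
    rw [measureReal_sdiff (hCA i) (hCm i), hp i]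
    linarith
  have hdisj : Pairwise (Function.onFun Disjoint fun i => A i \ C i) := by
    intro i j hij
    refine Set.disjoint_left.2 fun ω hi hj => hi.2 ?_
    exact Set.mem_biUnion (Finset.mem_erase.2 ⟨hij.symm, Finset.mem_univ j⟩) ⟨hi.1, hj.1⟩
  calc (Fintype.card ι : ℝ) * p / 2 = ∑ _i : ι, p / 2 := by simp; ring
    _ ≤ ∑ i, P.real (A i \ C i) := Finset.sum_le_sum fun i _ => hB i
    _ = P.real (⋃ i, A i \ C i) :=
      (measureReal_iUnion_fintype hdisj fun i => (hA i).diff (hCm i)).symm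
    _ ≤ P.real (⋃ i, A i) := measureReal_mono (Set.iUnion_mono fun _ => Set.sdiff_subset)

namespace IsSmoothStationaryGaussianField

variable {Ω : Type*} [MeasurableSpace Ω] {P : Measure Ω} {d : ℕ} {f : (Fin d → ℝ) → Ω → ℝ}

lemma measureReal_eval_gt (hf : IsSmoothStationaryGaussianField f P) (t : Fin d → ℝ) (b : ℝ) :
    P.real {ω | f t ω > b} = (gaussianReal 0 1).real (Set.Ioi b) := by
  rw [← hf.map_eval t, map_measureReal_apply (hf.measurable t) measurableSet_Ioi]
  rfl

lemma measureReal_inter_gt_le [IsProbabilityMeasure P] (hf : IsSmoothStationaryGaussianField f P)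
    {s t : Fin d → ℝ} (hst : variogram f P (s - t) ≤ 2) {b : ℝ} (hb : 0 ≤ b) :
    P.real ({ω | f s ω > b} ∩ {ω | f t ω > b}) ≤
      2 * Real.exp (-(b ^ 2 * variogram f P (s - t) / 8)) *
        (gaussianReal 0 1).real (Set.Ioi b) := by
  have hm := hf.measurable
  have h0 : 0 ≤ variogram f P (s - t) := variogram_nonneg _
  have h1 := gaussianReal_Ioi_le (v := 1 - variogram f P (s - t) / 4) (by linarith)
    (by linarith) hb
  rw [← hf.map_average s t, map_measureReal_apply (by fun_prop) measurableSet_Ioi] at h1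
  refine (measureReal_mono ?_).trans (h1.trans_eq ?_)
  · rintro ω ⟨hs, ht⟩
    simp only [Set.mem_ofPred_eq] at hs ht
    simp only [Set.mem_preimage, Set.mem_Ioi]
    linarith
  · ring_nf

lemma measureReal_exists_gt_le_card [IsProbabilityMeasure P]
    (hf : IsSmoothStationaryGaussianField f P) (S : Finset (Fin d → ℝ)) (b : ℝ) :
    P.real {ω | ∃ t ∈ S, f t ω > b} ≤ S.card * (gaussianReal 0 1).real (Set.Ioi b) := by
  have h : {ω | ∃ t ∈ S, f t ω > b} = ⋃ t ∈ S, {ω | f t ω > b} := by ext; simp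
  rw [h]
  refine (measureReal_biUnion_finset_le _ _).trans_eq ?_
  simp [hf.measureReal_eval_gt]

/-- Lower bound on the exceedance probability over a set containing a box, obtained from a grid of
mesh `b ^ (-α)`. -/
lemma grid_lower_bound [IsProbabilityMeasure P] (hf : IsSmoothStationaryGaussianField f P)
    {T : Set (Fin d → ℝ)} {x₀ : Fin d → ℝ} {c ρ α : ℝ}
    (hρ : 0 < ρ) (hT : ∀ h : Fin d → ℝ, ‖h‖ ≤ ρ → x₀ + h ∈ T)
    (hlow : ∀ h : Fin d → ℝ, ‖h‖ ≤ ρ → c * ‖h‖ ^ 2 ≤ variogram f P h)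
    (hup : ∀ h : Fin d → ℝ, ‖h‖ ≤ ρ → variogram f P h ≤ 2) (hc : 0 < c)
    {b : ℝ} (hb : 0 < b) (hb1 : 1 ≤ ρ * b ^ α)
    (hsmall : (ρ * b ^ α) ^ d * (2 * Real.exp (-(c / 8 * b ^ (2 - 2 * α)))) ≤ 1 / 2) :
    (ρ * b ^ α / 2) ^ d * (gaussianReal 0 1).real (Set.Ioi b) / 2 ≤
      P.real {ω | ∃ t ∈ T, f t ω > b} := by
  set p := (gaussianReal 0 1).real (Set.Ioi b) with hp
  have hp0 : 0 ≤ p := measureReal_nonneg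
  set m := ⌊ρ * b ^ α⌋₊ with hmdef
  set δ := b ^ (-α) with hδ
  have hδ0 : 0 < δ := Real.rpow_pos_of_pos hb _
  have hδb : δ * b ^ α = 1 := by rw [hδ, ← Real.rpow_add hb]; simp
  have hm_le : (m : ℝ) ≤ ρ * b ^ α := Nat.floor_le (by positivity)
  have hm_ge : ρ * b ^ α / 2 ≤ m := by
    have h1 := Nat.lt_floor_add_one (ρ * b ^ α)
    have h2 : (1 : ℝ) ≤ m := by exact_mod_cast Nat.one_le_floor_iff _ |>.2 hb1
    linarith
  have hmδ : δ * m ≤ ρ := by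
    calc δ * m ≤ δ * (ρ * b ^ α) := mul_le_mul_of_nonneg_left hm_le hδ0.le
      _ = ρ * (δ * b ^ α) := by ring
      _ = ρ := by rw [hδb, mul_one]
  let h : (Fin d → Fin m) → (Fin d → ℝ) := fun k i => δ * (k i : ℝ)
  have hh : ∀ k, ‖h k‖ ≤ ρ := by
    intro k
    refine (pi_norm_le_iff_of_nonneg hρ.le).2 fun i => ?_
    rw [Real.norm_of_nonneg (by positivity)]
    refine le_trans ?_ hmδ
    exact mul_le_mul_of_nonneg_left (by exact_mod_cast (k i).2.le) hδ0.le
  have hsub : ∀ k l, x₀ + h k - (x₀ + h l) = h k - h l := fun k l => add_sub_add_left_eq_sub _ _ _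
  have hdiff : ∀ k l, ‖h k - h l‖ ≤ ρ := by
    intro k l
    refine (pi_norm_le_iff_of_nonneg hρ.le).2 fun i => ?_
    simp only [Pi.sub_apply, h]
    rw [← mul_sub, Real.norm_eq_abs, abs_mul, abs_of_pos hδ0]
    refine le_trans (mul_le_mul_of_nonneg_left ?_ hδ0.le) hmδ
    have h1 : (k i : ℝ) ≤ m := by exact_mod_cast (k i).2.le
    have h2 : (l i : ℝ) ≤ m := by exact_mod_cast (l i).2.le
    have h3 : (0 : ℝ) ≤ (k i : ℝ) := Nat.cast_nonneg _
    have h4 : (0 : ℝ) ≤ (l i : ℝ) := Nat.cast_nonneg _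
    rw [abs_le]; constructor <;> linarith
  have hsep : ∀ k l, k ≠ l → δ ≤ ‖h k - h l‖ := by
    intro k l hkl
    obtain ⟨i, hi⟩ := Function.ne_iff.1 hkl
    refine le_trans ?_ (norm_le_pi_norm (h k - h l) i)
    simp only [Pi.sub_apply, h]
    rw [← mul_sub, Real.norm_eq_abs, abs_mul, abs_of_pos hδ0]
    refine le_mul_of_one_le_right hδ0.le ?_
    have h1 : ((k i : ℕ) : ℤ) - ((l i : ℕ) : ℤ) ≠ 0 := by
      intro h0
      exact hi (Fin.ext (by omega))
    exact_mod_cast Int.one_le_abs h1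
  have hbδ : b ^ 2 * δ ^ 2 = b ^ (2 - 2 * α) := by
    rw [hδ, ← Real.rpow_natCast, ← Real.rpow_natCast, ← Real.rpow_mul hb.le, ← Real.rpow_add hb]
    congr 1; push_cast; ring
  have hcard : (Fintype.card (Fin d → Fin m) : ℝ) = (m : ℝ) ^ d := by simp
  have hbon := half_card_mul_le_measureReal_iUnion (P := P)
    (A := fun k : Fin d → Fin m => {ω | f (x₀ + h k) ω > b}) (p := p)
    (ε := 2 * Real.exp (-(c / 8 * b ^ (2 - 2 * α))))
    (fun k => measurableSet_lt measurable_const (hf.measurable _)) (by positivity)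
    (fun k => hf.measureReal_eval_gt _ _) ?_ ?_
  · calc (ρ * b ^ α / 2) ^ d * p / 2 ≤ (m : ℝ) ^ d * p / 2 := by gcongr
      _ = (Fintype.card (Fin d → Fin m) : ℝ) * p / 2 := by rw [hcard]
      _ ≤ _ := hbon
      _ ≤ _ := measureReal_mono <| Set.iUnion_subset fun k ω hω =>
        show ∃ t ∈ T, f t ω > b from ⟨_, hT _ (hh k), hω⟩
  · intro k l hkl
    have hle := hup _ (hdiff k l)
    rw [← hsub k l] at hle
    refine (hf.measureReal_inter_gt_le hle hb.le).trans ?_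
    rw [hsub]
    refine mul_le_mul_of_nonneg_right ?_ hp0
    refine mul_le_mul_of_nonneg_left (Real.exp_le_exp.2 (neg_le_neg ?_)) (by norm_num)
    rw [← hbδ]
    have h1 : c * δ ^ 2 ≤ variogram f P (h k - h l) :=
      le_trans (by gcongr; exact hsep k l hkl) (hlow _ (hdiff k l))
    nlinarith [mul_le_mul_of_nonneg_left h1 (sq_nonneg b)]
  · rw [hcard]
    refine le_trans ?_ hsmall
    gcongr

end IsSmoothStationaryGaussianField

lemma eventually_pow_mul_exp_neg_le {ρ a α γ : ℝ} (d : ℕ) (ha : 0 < a) (hγ : 0 < γ) :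
    ∀ᶠ b : ℝ in atTop, (ρ * b ^ α) ^ d * (2 * Real.exp (-(a * b ^ γ))) ≤ 1 / 2 := by
  have h1 := (tendsto_rpow_mul_exp_neg_mul_atTop_nhds_zero (α * d / γ) a ha).comp
    (tendsto_rpow_atTop hγ)
  have h2 := h1.const_mul (2 * ρ ^ d)
  rw [mul_zero] at h2
  filter_upwards [h2.eventually_le_const (by norm_num : (0 : ℝ) < 1 / 2),
    eventually_ge_atTop 0] with b hb hb0
  refine le_trans (le_of_eq ?_) hb
  simp only [Function.comp_apply]
  rw [mul_pow, ← Real.rpow_natCast (b ^ α) d, ← Real.rpow_mul hb0, ← Real.rpow_mul hb0,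
    mul_div_cancel₀ _ hγ.ne', neg_mul]
  ring

lemma eventually_rpow_le_const_mul_rpow {β γ C : ℝ} (hβγ : β < γ) (hC : 0 < C) :
    ∀ᶠ b : ℝ in atTop, b ^ β ≤ C * b ^ γ := by
  have h := tendsto_rpow_neg_atTop (sub_pos.2 hβγ)
  filter_upwards [h.eventually_le_const hC, eventually_gt_atTop 0] with b hb hb0
  have h2 : b ^ β = b ^ (-(γ - β)) * b ^ γ := by
    rw [← Real.rpow_add hb0]; congr 1; ring
  rw [h2]
  gcongr

end GaussianFields

/-- Theorem `PropOpt`: optimality of the discretization size.  Under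
Conditions B1–B2 and for `θ ∈ (0,1)`,
`sup { P(sup_{t∈T̃} f(t) > b | sup_{t∈T} f(t) > b) : T̃ ⊆ T finite, #(T̃) ≤ b^{θd} } → 0`
as `b → ∞`. -/
theorem sparse_discretization_misses_maximum
    {Ω : Type} [MeasureSpace Ω] [IsProbabilityMeasure (ℙ : Measure Ω)]
    {d : ℕ} (hd : 0 < d)
    -- Condition B2: `T` is a compact convex `d`-dimensional set with nonempty interior,
    -- containing `0`, whose boundary is a `(d−1)`-dimensional manifold without boundary,
    -- and which has non-degenerate volume near every point
    (T : Set (Fin d → ℝ)) (hTcompact : IsCompact T) (hTconv : Convex ℝ T)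
    (hTint : (interior T).Nonempty) (h0T : (0 : Fin d → ℝ) ∈ T)
    (hTbdry : Nonempty (frontier T ≃ₜ Metric.sphere (0 : EuclideanSpace ℝ (Fin d)) 1))
    (κ₀ : ℝ) (hκ₀ : 0 < κ₀)
    (hB2 : ∀ t ∈ T, ∀ ε : ℝ, 0 < ε → ε < 1 →
      κ₀ * ε ^ d ≤ (volume ({s | nrm (s - t) ≤ ε} ∩ T)).toReal)
    -- Condition B1: `f` is a centered, unit-variance, homogeneous Gaussian field,
    -- almost surely twice continuously differentiable
    (f : (Fin d → ℝ) → Ω → ℝ) (hfmeas : ∀ t, Measurable (f t))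
    (hGauss : ∀ (n : ℕ) (t : Fin n → (Fin d → ℝ)) (c : Fin n → ℝ),
      ∃ v : NNReal,
        Measure.map (fun ω => ∑ i, c i * f (t i) ω) (ℙ : Measure Ω) = gaussianReal 0 v)
    (hvar : (∫ ω, (f 0 ω) ^ 2) = 1)
    (hstat : ∀ (n : ℕ) (t : Fin n → (Fin d → ℝ)) (h : Fin d → ℝ),
      Measure.map (fun ω (i : Fin n) => f (t i + h) ω) (ℙ : Measure Ω) =
        Measure.map (fun ω (i : Fin n) => f (t i) ω) (ℙ : Measure Ω))
    (hsmooth : ∀ᵐ ω ∂(ℙ : Measure Ω), ContDiff ℝ 2 (fun t => f t ω))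
    -- nondegeneracy: the global maximum over `T` is a.s. attained at a unique point
    (huniq : ∀ᵐ ω ∂(ℙ : Measure Ω), ∃! t, t ∈ T ∧ ∀ s ∈ T, f s ω ≤ f t ω)
    (θ : ℝ) (hθ0 : 0 < θ) (hθ1 : θ < 1) :
    ∀ η : ℝ, 0 < η → ∃ b₀ : ℝ, ∀ b : ℝ, b₀ ≤ b →
      ∀ S : Finset (Fin d → ℝ), ↑S ⊆ T → (S.card : ℝ) ≤ b ^ (θ * (d : ℝ)) →
        (ℙ {ω | ∃ t ∈ S, f t ω > b}).toReal /
            (ℙ {ω | ∃ t ∈ T, f t ω > b}).toReal ≤ η := by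
  intro η hη
  have hf : IsSmoothStationaryGaussianField f (ℙ : Measure Ω) :=
    ⟨hfmeas, hGauss, hvar, hstat, hsmooth⟩
  have hV := hf.nullDirections_eq_bot hTcompact hTconv hTint huniq
  obtain ⟨c, hc, r, hr, hlow⟩ := hf.exists_variogram_lower_bound (W := ⊤)
    (by rw [hV]; exact disjoint_bot_right)
  obtain ⟨r', hr', hup⟩ := Metric.eventually_nhds_iff_ball.1
    ((hf.continuous_variogram.tendsto' 0 0
      IsSmoothStationaryGaussianField.variogram_zero).eventually_le_const
        (by norm_num : (0 : ℝ) < 2))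
  obtain ⟨x₀, hx₀⟩ := hTint
  obtain ⟨r'', hr'', hball⟩ := Metric.isOpen_iff.1 isOpen_interior x₀ hx₀
  obtain ⟨ρ, hρ, hρlt⟩ := exists_between (lt_min hr (lt_min hr' hr''))
  obtain ⟨hρr, hρr'⟩ := lt_min_iff.1 hρlt
  obtain ⟨hρr', hρr''⟩ := lt_min_iff.1 hρr'
  set α := (1 + θ) / 2 with hα
  have hα0 : 0 < α := by linarith
  have hd' : (0 : ℝ) < d := Nat.cast_pos.2 hd
  have hev : ∀ᶠ b : ℝ in atTop, 0 < b ∧ 1 ≤ ρ * b ^ α ∧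
      (ρ * b ^ α) ^ d * (2 * Real.exp (-(c / 8 * b ^ (2 - 2 * α)))) ≤ 1 / 2 ∧
      b ^ (θ * d) ≤ η * (ρ / 2) ^ d / 2 * b ^ (α * d) := by
    filter_upwards [eventually_gt_atTop 0,
      ((tendsto_rpow_atTop hα0).const_mul_atTop hρ).eventually_ge_atTop 1,
      eventually_pow_mul_exp_neg_le (ρ := ρ) (α := α) d (by positivity : 0 < c / 8)
        (by linarith : 0 < 2 - 2 * α),
      eventually_rpow_le_const_mul_rpow
        (by nlinarith : θ * (d : ℝ) < α * d) (by positivity : 0 < η * (ρ / 2) ^ d / 2)]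
      with b h1 h2 h3 h4 using ⟨h1, h2, h3, h4⟩
  obtain ⟨b₀, hb₀⟩ := eventually_atTop.1 hev
  refine ⟨b₀, fun b hb S _ hcard => ?_⟩
  obtain ⟨hb0, hb1, hsmall, hratio⟩ := hb₀ b hb
  refine div_le_of_le_mul₀ ENNReal.toReal_nonneg hη.le ?_
  have hden := hf.grid_lower_bound (T := T) (x₀ := x₀) hρ
    (fun h hh => interior_subset (hball (by simpa using hh.trans_lt hρr'')))
    (fun h hh => hlow h trivial (hh.trans_lt hρr))
    (fun h hh => hup h (by simpa using hh.trans_lt hρr')) hc hb0 hb1 hsmall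
  calc (ℙ {ω | ∃ t ∈ S, f t ω > b}).toReal
      ≤ S.card * (gaussianReal 0 1).real (Set.Ioi b) := hf.measureReal_exists_gt_le_card S b
    _ ≤ η * (ρ / 2) ^ d / 2 * b ^ (α * d) * (gaussianReal 0 1).real (Set.Ioi b) := by
      gcongr
      exact hcard.trans hratio
    _ = η * ((ρ * b ^ α / 2) ^ d * (gaussianReal 0 1).real (Set.Ioi b) / 2) := by
      rw [Real.rpow_mul hb0.le, Real.rpow_natCast, mul_div_right_comm ρ, mul_pow]
      ring
    _ ≤ η * (ℙ {ω | ∃ t ∈ T, f t ω > b}).toReal := mul_le_mul_of_nonneg_left hden hη.le
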